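/- arXiv:2201.12703 — 3 statements merged into one kernel-verified Lean document; each statement's English description precedes it below -/
import Mathlib

section
/- Let n ≥ 1 and let d : ZMod n → ℤ satisfy d j ≠ -1 for every j. If there exists a function a : ZMod n → ℤ with a j > 0 for all j and a (j-1) + (a j) * (d j) + a (j+1) > 0 for all j, then there exists some j with d j ≥ 0. (This is the numerical content of the paper's lemma: if a Looijenga pair (Y,D) is positive and D_i² ≠ -1 for all i, then D_j² ≥ 0 for some j; the proof is by summing the inequalities: 2∑ a_j > ∑ a_j(-d_j) ≥ 2∑ a_j when all d_j ≤ -2, a contradiction.) -/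
/-- Numerical content of the lemma: if a Looijenga pair `(Y,D)` is positive
(witnessed by positive integers `a j` with `a (j-1) + a j * d j + a (j+1) > 0`
for all `j`, where `d j = D_j²`) and `d j ≠ -1` for all `j`, then `d j ≥ 0`
for some `j`. -/
theorem positive_pair_exists_nonneg_selfintersection
    (n : ℕ) (hn : 1 ≤ n) (d : ZMod n → ℤ) (hd : ∀ j, d j ≠ -1)
    (h : ∃ a : ZMod n → ℤ, (∀ j, 0 < a j) ∧
      ∀ j, 0 < a (j - 1) + a j * d j + a (j + 1)) :
    ∃ j, 0 ≤ d j := by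
  obtain ⟨a, ha, hpos⟩ := h
  have : NeZero n := ⟨by omega⟩
  by_contra! hneg
  have hsum : 0 < ∑ j, (a (j - 1) + a j * (-2) + a (j + 1)) := by
    refine Finset.sum_pos (fun j _ => (hpos j).trans_le ?_) Finset.univ_nonempty
    have hle : d j ≤ -2 := by
      have := hd j
      have := hneg j
      omega
    gcongr
    exact (ha j).le
  have hpred : ∑ j, a (j - 1) = ∑ j, a j := Equiv.sum_comp (Equiv.subRight (1 : ZMod n)) a
  have hsucc : ∑ j, a (j + 1) = ∑ j, a j := Equiv.sum_comp (Equiv.addRight (1 : ZMod n)) a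
  rw [Finset.sum_add_distrib, Finset.sum_add_distrib, ← Finset.sum_mul, hpred, hsucc] at hsum
  linarith
end

section
/- Let n ≥ 1 and let d : ZMod n → ℤ. If there exists an index i₀ with d i₀ ≥ 0, then there exists a function a : ZMod n → ℤ with a j > 0 for all j and a (j-1) + (a j) * (d j) + a (j+1) > 0 for all j. (This is the numerical core of the paper's proposition that a positive Looijenga pair (Y,D) with n ≥ 2 and some D_i² ≥ 0 admits a parallel configuration: assuming WLOG d_1 ≥ 0, one sets a_2 = 1 and recursively a_{i+1} = 1 if d_i ≥ 0 and a_{i+1} = (-d_i)·a_i + 1 if d_i < 0, and verifies all the cyclic inequalities.) -/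
namespace ParallelConfiguration

theorem val_add_one_of_add_one_ne_zero {n : ℕ} [NeZero n] {x : ZMod n} (hx : x + 1 ≠ 0) :
    (x + 1).val = x.val + 1 := by
  have hcast : ((x.val + 1 : ℕ) : ZMod n) = x + 1 := by simp
  have hne : x.val + 1 ≠ n := fun he => hx (by rw [← hcast, he, ZMod.natCast_self])
  have hlt : x.val + 1 < n := lt_of_le_of_ne x.val_lt hne
  rw [← hcast, ZMod.val_cast_of_lt hlt]

/-- The sequence with `weight e 0 = 1` and `weight e (k + 1) = |e k| * weight e k + 1`. -/
def weight (e : ℕ → ℤ) : ℕ → ℤ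
  | 0 => 1
  | k + 1 => |e k| * weight e k + 1

theorem weight_pos (e : ℕ → ℤ) (k : ℕ) : 0 < weight e k := by
  induction k with
  | zero => exact one_pos
  | succ k ih => rw [weight]; positivity

theorem weight_mul_add_weight_succ_pos (e : ℕ → ℤ) (k : ℕ) :
    0 < weight e k * e k + weight e (k + 1) := by
  rw [weight]
  nlinarith [weight_pos e k, neg_abs_le (e k)]

end ParallelConfiguration

open ParallelConfiguration

/-- Numerical core of the proposition that a Looijenga pair with some `D_i² ≥ 0`
admits a parallel configuration: if `d i₀ ≥ 0` for some index `i₀`, then there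
exist positive integers `a j` with `a (j-1) + a j * d j + a (j+1) > 0` for all
`j`. -/
theorem exists_parallel_configuration_weights
    (n : ℕ) (hn : 1 ≤ n) (d : ZMod n → ℤ) (h : ∃ i₀, 0 ≤ d i₀) :
    ∃ a : ZMod n → ℤ, (∀ j, 0 < a j) ∧
      ∀ j, 0 < a (j - 1) + a j * d j + a (j + 1) := by
  obtain ⟨i₀, hi₀⟩ := h
  have : NeZero n := ⟨by omega⟩
  set e : ℕ → ℤ := fun k => d (i₀ + 1 + k) with he
  have hpos (j : ZMod n) : 0 < weight e (j - i₀ - 1).val := weight_pos _ _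
  refine ⟨fun j => weight e (j - i₀ - 1).val, hpos, fun j => ?_⟩
  beta_reduce
  by_cases hj : j = i₀
  · subst hj
    have := mul_nonneg (hpos j).le hi₀
    linarith [hpos (j - 1), hpos (j + 1)]
  · have hsucc : (j + 1 - i₀ - 1).val = (j - i₀ - 1).val + 1 := by
      rw [← val_add_one_of_add_one_ne_zero (by simpa [sub_eq_zero] using hj)]
      congr 1
      ring
    have hd : e (j - i₀ - 1).val = d j := by
      simp [he]
    have := weight_mul_add_weight_succ_pos e (j - i₀ - 1).val
    rw [hd, ← hsucc] at this
    linarith [hpos (j - 1)]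
end

section
/- In the degree-one del Pezzo lattice L, let D₁ = 3F + C − E₁ − E₂ − ⋯ − E₈, D₂ = F − E₉, D₃ = C, and D₄ = F − E₁₀. Then the orthogonal complement {x ∈ L : B(x, D₁) = B(x, D₂) = B(x, D₃) = B(x, D₄) = 0} equals the ℤ-span of the eight vectors α₀ := 3F + C − E₁ − E₂ − E₃ − E₉ − E₁₀ and α_i := E_i − E_{i+1} for i = 1, …, 7. (This is the paper's computation of D^⊥ for the toric model (F₃, D̄) of a blowup of the degree-1 del Pezzo pair: D^⊥ = ⟨E₁−E₂, …, E₇−E₈, 3F+C−E₁−E₂−E₃−E₉−E₁₀⟩.) -/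
/-! The degree-one del Pezzo lattice: the free `ℤ`-module of rank 12 with
basis `C, F, E₁, …, E₁₀` (indexed as `0, 1, 2, …, 11`) and the intersection
form of the surface obtained from the Hirzebruch surface `F₃` by 10 blowups:
`C·C = -3`, `F·F = 0`, `C·F = 1`, `Eᵢ·Eⱼ = -δᵢⱼ·1`, `C·Eᵢ = F·Eᵢ = 0`. -/

/-- The underlying free `ℤ`-module of rank 12. -/
abbrev DelPezzoLattice : Type := Fin 12 → ℤ

/-- The class `C` (pullback of the `(-3)`-curve of `F₃`). -/
def Cv : DelPezzoLattice := Pi.single 0 1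

/-- The class `F` (pullback of a fiber of `F₃`). -/
def Fv : DelPezzoLattice := Pi.single 1 1

/-- The exceptional classes `E₁, …, E₁₀` (0-indexed: `Ev i = E_{i+1}`). -/
def Ev (i : Fin 10) : DelPezzoLattice :=
  Pi.single (⟨(i : ℕ) + 2, by have := i.isLt; omega⟩ : Fin 12) 1

/-- Gram matrix of the intersection form in the basis `C, F, E₁, …, E₁₀`. -/
def gram (i j : Fin 12) : ℤ :=
  if i = 0 ∧ j = 0 then -3
  else if (i = 0 ∧ j = 1) ∨ (i = 1 ∧ j = 0) then 1
  else if i = j ∧ 2 ≤ (i : ℕ) then -1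
  else 0

/-- The intersection form `B`. -/
def B (x y : DelPezzoLattice) : ℤ := ∑ i, ∑ j, x i * gram i j * y j

/-- `D₁ = 3F + C − E₁ − ⋯ − E₈`. -/
def D₁ : DelPezzoLattice :=
  (3 : ℤ) • Fv + Cv - ∑ i : Fin 8, Ev (Fin.castLE (by norm_num) i)

/-- `D₂ = F − E₉`. -/
def D₂ : DelPezzoLattice := Fv - Ev 8

/-- `D₃ = C`. -/
def D₃ : DelPezzoLattice := Cv

/-- `D₄ = F − E₁₀`. -/
def D₄ : DelPezzoLattice := Fv - Ev 9

/-- `α₀ = 3F + C − E₁ − E₂ − E₃ − E₉ − E₁₀`. -/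
def α₀ : DelPezzoLattice :=
  (3 : ℤ) • Fv + Cv - Ev 0 - Ev 1 - Ev 2 - Ev 8 - Ev 9

/-- `αs i = E_{i+1} − E_{i+2}` for `i = 0, …, 6`, i.e. the vectors
`α_i = E_i − E_{i+1}` for `i = 1, …, 7` of the paper. -/
def αs (i : Fin 7) : DelPezzoLattice :=
  Ev (Fin.castLE (by norm_num) i) - Ev ⟨(i : ℕ) + 1, by have := i.isLt; omega⟩

/-- The intersection form in the coordinates of the basis `C, F, E₁, …, E₁₀`. -/
theorem B_eq_coordinates (x y : DelPezzoLattice) :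
    B x y = -3 * x 0 * y 0 + x 0 * y 1 + x 1 * y 0 - (x 2 * y 2 + x 3 * y 3 + x 4 * y 4 +
      x 5 * y 5 + x 6 * y 6 + x 7 * y 7 + x 8 * y 8 + x 9 * y 9 + x 10 * y 10 + x 11 * y 11) := by
  have key (i : Fin 12) : ∑ j, x i * gram i j * y j =
      (![-3 * x 0 * y 0 + x 0 * y 1, x 1 * y 0, -x 2 * y 2, -x 3 * y 3, -x 4 * y 4, -x 5 * y 5,
        -x 6 * y 6, -x 7 * y 7, -x 8 * y 8, -x 9 * y 9, -x 10 * y 10, -x 11 * y 11] :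
        Fin 12 → ℤ) i := by
    fin_cases i <;>
      simp [gram, Fin.sum_univ_succ, -Fin.val_eq_zero_iff, Fin.ext_iff, -mul_eq_mul_right_iff] <;>
      ring
  simp only [B, key]
  simp [Fin.sum_univ_succ]
  ring

/-- The orthogonality conditions written in the coordinates of the basis `C, F, E₁, …, E₁₀`. -/
theorem orthogonal_iff_coordinates (x : DelPezzoLattice) :
    (B x D₁ = 0 ∧ B x D₂ = 0 ∧ B x D₃ = 0 ∧ B x D₄ = 0) ↔
      x 1 = 3 * x 0 ∧ x 10 = -x 0 ∧ x 11 = -x 0 ∧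
        x 2 + x 3 + x 4 + x 5 + x 6 + x 7 + x 8 + x 9 = -3 * x 0 := by
  simp only [B_eq_coordinates]
  simp [D₁, D₂, D₃, D₄, Fv, Cv, Ev, Fin.sum_univ_succ, Fin.ext_iff]
  lia

/-- A vector orthogonal to the `Dᵢ` is an explicit combination of `α₀` and the `αs i`. -/
theorem eq_combination_of_coordinates (x : DelPezzoLattice)
    (hF : x 1 = 3 * x 0) (h₉ : x 10 = -x 0) (h₁₀ : x 11 = -x 0)
    (hE : x 2 + x 3 + x 4 + x 5 + x 6 + x 7 + x 8 + x 9 = -3 * x 0) :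
    x = x 0 • α₀ + ∑ i, (![x 2 + x 0, x 2 + x 3 + 2 * x 0, x 2 + x 3 + x 4 + 3 * x 0,
      -(x 6 + x 7 + x 8 + x 9), -(x 7 + x 8 + x 9), -(x 8 + x 9), -x 9] : Fin 7 → ℤ) i • αs i := by
  ext k
  fin_cases k <;>
    simp [α₀, αs, Fv, Cv, Ev, Fin.sum_univ_succ, Fin.ext_iff] <;> lia

/-- The orthogonal complement of `{D₁, D₂, D₃, D₄}` in the degree-one del Pezzo
lattice equals the `ℤ`-span of the eight vectors
`α₀ = 3F + C − E₁ − E₂ − E₃ − E₉ − E₁₀` and `α_i = E_i − E_{i+1}`,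
`i = 1, …, 7`. -/
theorem delPezzo_orthogonal_complement :
    {x : DelPezzoLattice |
        B x D₁ = 0 ∧ B x D₂ = 0 ∧ B x D₃ = 0 ∧ B x D₄ = 0} =
      ↑(Submodule.span ℤ ({α₀} ∪ Set.range αs)) := by
  ext x
  rw [Set.mem_ofPred_eq, orthogonal_iff_coordinates, SetLike.mem_coe]
  constructor
  · rintro ⟨hF, h₉, h₁₀, hE⟩
    rw [eq_combination_of_coordinates x hF h₉ h₁₀ hE]
    exact add_mem (Submodule.smul_mem _ _ (Submodule.subset_span (Or.inl rfl)))
      (sum_mem fun i _ => Submodule.smul_mem _ _ (Submodule.subset_span (Or.inr ⟨i, rfl⟩)))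
  · intro hx
    induction hx using Submodule.span_induction with
    | mem y hy =>
      rcases hy with rfl | ⟨i, rfl⟩
      · simp [α₀, Fv, Cv, Ev, Fin.ext_iff]
      · fin_cases i <;> simp [αs, Ev, Fin.ext_iff]
    | zero => simp
    | add y z _ _ hy hz => simp only [Pi.add_apply]; lia
    | smul a y _ hy =>
      obtain ⟨hF, h₉, h₁₀, hE⟩ := hy
      simp only [Pi.smul_apply, smul_eq_mul]
      exact ⟨by rw [hF]; ring, by rw [h₉]; ring, by rw [h₁₀]; ring,
        by linear_combination a * hE⟩
end
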